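/- Let T1 and T2 be finite rooted trees, let v be a vertex of T1 and u a vertex of T2, and suppose v is a leaf or u is a leaf. Then the distance between the covers of an optimal top-down amalgam of the subtree of T1 rooted at v and the subtree of T2 rooted at u equals max{height(v), height(u)}, where height denotes the height of the vertex in its tree. -/

import Mathlib

namespace HDTrees

open SimpleGraph Set

/-- A vertex set `S` is convex in `G`: the induced subgraph is connected and every
shortest path between vertices of `S` stays inside `S`. -/
def ConvexIn {V : Type*} (G : SimpleGraph V) (S : Set V) : Prop :=
  (G.induce S).Connected ∧
    ∀ u ∈ S, ∀ v ∈ S, ∀ p : G.Walk u v, p.length = G.dist u v →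
      ∀ x ∈ p.support, x ∈ S

/-- `A` is an amalgam of `G₁` and `G₂` along the embeddings `f₁`, `f₂`:
the two covers exhaust the vertices and edges of `A`, and the intersection of the
covers corresponds to a convex subgraph on each side. -/
structure IsAmalgam {V₁ V₂ W : Type*} (G₁ : SimpleGraph V₁) (G₂ : SimpleGraph V₂)
    (A : SimpleGraph W) (f₁ : G₁ ↪g A) (f₂ : G₂ ↪g A) : Prop where
  vcover : Set.range ⇑f₁ ∪ Set.range ⇑f₂ = Set.univ
  ecover : ∀ x y : W, A.Adj x y →
    (x ∈ Set.range ⇑f₁ ∧ y ∈ Set.range ⇑f₁) ∨ (x ∈ Set.range ⇑f₂ ∧ y ∈ Set.range ⇑f₂)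
  conv₁ : ConvexIn G₁ (⇑f₁ ⁻¹' Set.range ⇑f₂)
  conv₂ : ConvexIn G₂ (⇑f₂ ⁻¹' Set.range ⇑f₁)

/-- Distance from a vertex to a set of vertices. -/
noncomputable def distToSet {W : Type*} (A : SimpleGraph W) (u : W) (S : Set W) : ℕ :=
  sInf (A.dist u '' S)

/-- The distance between the covers of an amalgam `A` whose intersection has
vertex set `S`: the maximum over vertices of `A` of the distance to `S`. -/
noncomputable def coverDist {W : Type*} (A : SimpleGraph W) (S : Set W) : ℕ :=
  sSup (Set.range fun u => distToSet A u S)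

open scoped Classical in
/-- The Hausdorff distance between two graphs. -/
noncomputable def hausdorffDist {V₁ V₂ : Type*} (G₁ : SimpleGraph V₁)
    (G₂ : SimpleGraph V₂) : ℕ :=
  if Nonempty (G₁ ≃g G₂) then 0
  else sInf {n : ℕ | ∃ (W : Type) (A : SimpleGraph W) (f₁ : G₁ ↪g A) (f₂ : G₂ ↪g A),
    Finite W ∧ IsAmalgam G₁ G₂ A f₁ f₂ ∧
      coverDist A (Set.range ⇑f₁ ∩ Set.range ⇑f₂) = n}

/-- Eccentricity of a vertex. -/
noncomputable def ecc {V : Type*} (G : SimpleGraph V) (v : V) : ℕ := sSup (Set.range (G.dist v))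

/-- Radius of a graph. -/
noncomputable def grad {V : Type*} (G : SimpleGraph V) : ℕ := sInf (Set.range (ecc G))

/-- Diameter of a graph. -/
noncomputable def gdiam {V : Type*} (G : SimpleGraph V) : ℕ := sSup (Set.range (ecc G))

/-- In the tree `T` rooted at `r`, `p` is the parent of `v`. -/
def IsParent {V : Type*} (T : SimpleGraph V) (r p v : V) : Prop :=
  T.Adj v p ∧ T.dist r p + 1 = T.dist r v

/-- The set of children of `v` in the tree `T` rooted at `r`. -/
def childSet {V : Type*} (T : SimpleGraph V) (r v : V) : Set V := {u | IsParent T r v u}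

/-- The vertex set of the subtree rooted at `v` (i.e. `v` and its descendants)
in the tree `T` rooted at `r`. -/
def subtreeSet {V : Type*} (T : SimpleGraph V) (r v : V) : Set V :=
  {u | T.dist r u = T.dist r v + T.dist v u}

lemma mem_subtreeSet_self {V : Type*} (T : SimpleGraph V) (r v : V) :
    v ∈ subtreeSet T r v := by simp [subtreeSet]

/-- The height of the vertex `v` in the tree `T` rooted at `r`. -/
noncomputable def heightV {V : Type*} (T : SimpleGraph V) (r v : V) : ℕ :=
  sSup (T.dist v '' subtreeSet T r v)

/-- The distance between the covers of an optimal top-down amalgam of the rooted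
trees `(T₁, r₁)` and `(T₂, r₂)`: the minimum of the distance between the covers
over all amalgams identifying the two roots. -/
noncomputable def topDownDist {V₁ V₂ : Type*} (T₁ : SimpleGraph V₁) (r₁ : V₁)
    (T₂ : SimpleGraph V₂) (r₂ : V₂) : ℕ :=
  sInf {n : ℕ | ∃ (W : Type) (A : SimpleGraph W) (f₁ : T₁ ↪g A) (f₂ : T₂ ↪g A),
    Finite W ∧ IsAmalgam T₁ T₂ A f₁ f₂ ∧ f₁ r₁ = f₂ r₂ ∧
      coverDist A (Set.range ⇑f₁ ∩ Set.range ⇑f₂) = n}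

/-- `D(x, y)`: the distance between the covers of an optimal top-down amalgam of
the subtree of `(T₁, r₁)` rooted at `x` and the subtree of `(T₂, r₂)` rooted at `y`. -/
noncomputable def subtreeDist {V₁ V₂ : Type*} (T₁ : SimpleGraph V₁) (r₁ : V₁)
    (T₂ : SimpleGraph V₂) (r₂ : V₂) (x : V₁) (y : V₂) : ℕ :=
  topDownDist (T₁.induce (subtreeSet T₁ r₁ x)) ⟨x, mem_subtreeSet_self T₁ r₁ x⟩
    (T₂.induce (subtreeSet T₂ r₂ y)) ⟨y, mem_subtreeSet_self T₂ r₂ y⟩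

/-- `S` is (the vertex set of) a top-down subtree of the tree `T` rooted at `r`. -/
def IsTopDown {V : Type*} (T : SimpleGraph V) (r : V) (S : Set V) : Prop :=
  r ∈ S ∧ ∀ v ∈ S, v ≠ r → ∀ p : V, IsParent T r p v → p ∈ S

/-- `M` is a rooted tree isomorphism (as a set of pairs) between subsets of the rooted
trees `(T₁, r₁)` and `(T₂, r₂)`: it is functional and injective in both coordinates,
matches the roots and maps parents to parents. -/
def IsRootedIso {V₁ V₂ : Type*} (T₁ : SimpleGraph V₁) (r₁ : V₁)
    (T₂ : SimpleGraph V₂) (r₂ : V₂) (M : Set (V₁ × V₂)) : Prop :=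
  (r₁, r₂) ∈ M ∧
  (∀ v w w', (v, w) ∈ M → (v, w') ∈ M → w = w') ∧
  (∀ v v' w, (v, w) ∈ M → (v', w) ∈ M → v = v') ∧
  (∀ v w, (v, w) ∈ M → (v = r₁ ↔ w = r₂)) ∧
  (∀ v w, (v, w) ∈ M → ∀ pv, IsParent T₁ r₁ pv v → ∀ pw, IsParent T₂ r₂ pw w →
    (pv, pw) ∈ M)

/-- The inductive description of the reconstructed mapping `M ⊆ M'`:
`(r₁, r₂) ∈ M`, and a pair of non-root vertices lies in `M` iff it lies in `M'`
and the pair of parents lies in `M`. -/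
def ReconFix {V₁ V₂ : Type*} (T₁ : SimpleGraph V₁) (r₁ : V₁)
    (T₂ : SimpleGraph V₂) (r₂ : V₂) (M' M : Set (V₁ × V₂)) : Prop :=
  ∀ v w, (v, w) ∈ M ↔ ((v, w) ∈ M' ∧
    ((v = r₁ ∧ w = r₂) ∨ (v ≠ r₁ ∧ w ≠ r₂ ∧
      ∃ pv pw, IsParent T₁ r₁ pv v ∧ IsParent T₂ r₂ pw w ∧ (pv, pw) ∈ M)))

section Dist

variable {V W : Type*}

lemma dist_map_le {G : SimpleGraph V} {H : SimpleGraph W} (hG : G.Connected) (f : G →g H)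
    (a b : V) : H.dist (f a) (f b) ≤ G.dist a b := by
  obtain ⟨p, hp⟩ := hG.exists_walk_length_eq_dist a b
  rw [← hp, ← Walk.length_map f p]
  exact dist_le _

lemma dist_iso {G : SimpleGraph V} {H : SimpleGraph W} (hG : G.Connected) (e : G ≃g H)
    (a b : V) : H.dist (e a) (e b) = G.dist a b := by
  refine le_antisymm (dist_map_le hG e.toHom a b) ?_
  simpa using dist_map_le (e.connected_iff.mp hG) e.symm.toHom (e a) (e b)

end Dist

section Subtree

variable {V : Type*} {T : SimpleGraph V} {r v : V}

/-- A geodesic from `v` to one of its descendants stays inside the subtree rooted at `v`. -/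
lemma support_subset_subtreeSet (hT : T.Connected) {u : V} (hu : u ∈ subtreeSet T r v)
    (p : T.Walk v u) (hp : p.length = T.dist v u) : ∀ x ∈ p.support, x ∈ subtreeSet T r v := by
  classical
  intro x hx
  have hlen : (p.takeUntil x hx).length + (p.dropUntil x hx).length = p.length := by
    rw [← Walk.length_append, Walk.take_spec]
  have h₁ := dist_le (p.takeUntil x hx)
  have h₂ := dist_le (p.dropUntil x hx)
  have h₃ : T.dist r x ≤ T.dist r v + T.dist v x := hT.dist_triangle
  have h₄ : T.dist r u ≤ T.dist r x + T.dist x u := hT.dist_triangle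
  simp only [subtreeSet, Set.mem_ofPred_eq] at hu ⊢
  omega

lemma exists_walk_induce_subtreeSet (hT : T.Connected) (u : subtreeSet T r v) :
    ∃ p : (T.induce (subtreeSet T r v)).Walk ⟨v, mem_subtreeSet_self T r v⟩ u,
      p.length = T.dist v u := by
  obtain ⟨p, hp⟩ := hT.exists_walk_length_eq_dist v u
  have hs := support_subset_subtreeSet hT u.2 p hp
  refine ⟨p.induce _ hs, ?_⟩
  rw [← hp]
  conv_rhs => rw [← Walk.map_induce p hs]
  exact (Walk.length_map _ _).symm

lemma connected_induce_subtreeSet (hT : T.Connected) :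
    (T.induce (subtreeSet T r v)).Connected := by
  have h : ∀ u, (T.induce (subtreeSet T r v)).Reachable ⟨v, mem_subtreeSet_self T r v⟩ u :=
    fun u => ⟨(exists_walk_induce_subtreeSet hT u).choose⟩
  have : Nonempty (subtreeSet T r v) := ⟨⟨v, mem_subtreeSet_self T r v⟩⟩
  exact ⟨fun a b => (h a).symm.trans (h b)⟩

lemma dist_induce_subtreeSet (hT : T.Connected) (u : subtreeSet T r v) :
    (T.induce (subtreeSet T r v)).dist ⟨v, mem_subtreeSet_self T r v⟩ u = T.dist v u := by
  refine le_antisymm ?_ (dist_map_le (connected_induce_subtreeSet hT)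
    (Embedding.induce (subtreeSet T r v)).toHom
    ⟨v, mem_subtreeSet_self T r v⟩ u)
  obtain ⟨p, hp⟩ := exists_walk_induce_subtreeSet hT u
  exact hp ▸ dist_le p

lemma ecc_induce_subtreeSet (hT : T.Connected) :
    ecc (T.induce (subtreeSet T r v)) ⟨v, mem_subtreeSet_self T r v⟩ = heightV T r v := by
  unfold ecc heightV
  congr 1
  ext n
  simp [dist_induce_subtreeSet hT]

lemma subtreeSet_eq_singleton (hT : T.Connected) (h : childSet T r v = ∅) :
    subtreeSet T r v = {v} := by
  refine Set.eq_singleton_iff_unique_mem.mpr ⟨mem_subtreeSet_self T r v, fun u hu => ?_⟩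
  obtain ⟨p, hp⟩ := hT.exists_walk_length_eq_dist v u
  have hs := support_subset_subtreeSet hT hu p hp
  cases p with
  | nil => rfl
  | @cons _ y _ hadj q =>
    have hy : y ∈ subtreeSet T r v := hs y (by simp)
    have hy' : T.dist r y = T.dist r v + T.dist v y := hy
    rw [dist_eq_one_iff_adj.mpr hadj] at hy'
    have : y ∈ childSet T r v := ⟨hadj.symm, hy'.symm⟩
    simp [h] at this

lemma heightV_eq_zero (hT : T.Connected) (h : childSet T r v = ∅) : heightV T r v = 0 := by
  simp [heightV, subtreeSet_eq_singleton hT h]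

end Subtree

section Amalgam

variable {V₁ V₂ : Type*}

lemma convexIn_univ {G : SimpleGraph V₁} (hG : G.Connected) : ConvexIn G Set.univ :=
  ⟨(induceUnivIso G).connected_iff.mpr hG, by simp⟩

lemma convexIn_singleton (G : SimpleGraph V₁) (r : V₁) : ConvexIn G {r} := by
  refine ⟨?_, ?_⟩
  · exact ⟨fun a b => by rw [Subsingleton.elim a b]⟩
  · rintro a rfl b rfl p hp x hx
    rw [dist_self] at hp
    rw [(Walk.length_eq_zero_iff.mp hp).eq_nil] at hx
    simpa using hx

lemma IsAmalgam.symm {W : Type*} {G₁ : SimpleGraph V₁} {G₂ : SimpleGraph V₂}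
    {A : SimpleGraph W} {f₁ : G₁ ↪g A} {f₂ : G₂ ↪g A} (h : IsAmalgam G₁ G₂ A f₁ f₂) :
    IsAmalgam G₂ G₁ A f₂ f₁ :=
  ⟨by rw [Set.union_comm, h.vcover], fun x y hxy => (h.ecover x y hxy).symm, h.conv₂, h.conv₁⟩

lemma topDownDist_comm (G₁ : SimpleGraph V₁) (r₁ : V₁) (G₂ : SimpleGraph V₂) (r₂ : V₂) :
    topDownDist G₁ r₁ G₂ r₂ = topDownDist G₂ r₂ G₁ r₁ := by
  unfold topDownDist
  congr 1
  ext n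
  constructor <;>
  · rintro ⟨W, A, f, g, hW, hA, hr, hn⟩
    exact ⟨W, A, g, f, hW, hA.symm, hr.symm, by rw [Set.inter_comm, hn]⟩

lemma coverDist_singleton {W : Type*} (A : SimpleGraph W) (w : W) :
    coverDist A {w} = ecc A w := by
  simp [coverDist, ecc, distToSet, dist_comm]

lemma ecc_iso {W : Type*} {G : SimpleGraph V₁} {A : SimpleGraph W} (hG : G.Connected)
    (e : G ≃g A) (a : V₁) : ecc A (e a) = ecc G a := by
  unfold ecc
  rw [← e.surjective.range_comp (A.dist (e a))]
  congr 2
  ext b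
  exact dist_iso hG e a b

lemma topDownDist_of_subsingleton [Subsingleton V₁] [Finite V₂]
    (G₁ : SimpleGraph V₁) (r₁ : V₁) (G₂ : SimpleGraph V₂) (r₂ : V₂) (hG₂ : G₂.Connected) :
    topDownDist G₁ r₁ G₂ r₂ = ecc G₂ r₂ := by
  have key : {n : ℕ | ∃ (W : Type) (A : SimpleGraph W) (f₁ : G₁ ↪g A) (f₂ : G₂ ↪g A),
      Finite W ∧ IsAmalgam G₁ G₂ A f₁ f₂ ∧ f₁ r₁ = f₂ r₂ ∧
        coverDist A (Set.range ⇑f₁ ∩ Set.range ⇑f₂) = n} = {ecc G₂ r₂} := by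
    refine Set.eq_singleton_iff_unique_mem.mpr ⟨?_, ?_⟩
    · obtain ⟨n, ⟨e⟩⟩ := Finite.exists_equiv_fin V₂
      let A : SimpleGraph (Fin n) := G₂.map e.toEmbedding
      let f₂ : G₂ ≃g A := Iso.map e G₂
      let f₁ : G₁ ↪g A :=
        { toFun := fun _ => f₂ r₂
          inj' := fun a b _ => Subsingleton.elim a b
          map_rel_iff' := by
            intro a b
            rw [Subsingleton.elim a b]
            simp }
      have hf₁ : Set.range ⇑f₁ = {f₂ r₂} := by
        ext x
        exact ⟨fun ⟨_, h⟩ => h.symm, fun h => ⟨r₁, h.symm⟩⟩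
      have hf₂ : Set.range ⇑f₂.toEmbedding = Set.univ := f₂.surjective.range_eq
      refine ⟨Fin n, A, f₁, f₂.toEmbedding, inferInstance, ⟨?_, ?_, ?_, ?_⟩, rfl, ?_⟩
      · rw [hf₂, Set.union_univ]
      · intro x y _
        simp
      · rw [hf₂, Set.preimage_univ]
        refine convexIn_univ ?_
        have : Nonempty V₁ := ⟨r₁⟩
        exact ⟨fun a b => by rw [Subsingleton.elim a b]⟩
      · have : ⇑f₂.toEmbedding ⁻¹' Set.range ⇑f₁ = {r₂} := by
          ext x
          simp [hf₁]
        rw [this]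
        exact convexIn_singleton G₂ r₂
      · rw [hf₂, Set.inter_univ, hf₁, coverDist_singleton, ecc_iso hG₂]
    · rintro n ⟨W, A, f₁, f₂, -, hA, hr, rfl⟩
      have hf₁ : Set.range ⇑f₁ = {f₂ r₂} := by
        ext x
        refine ⟨?_, fun h => ⟨r₁, hr.trans h.symm⟩⟩
        rintro ⟨a, rfl⟩
        rw [Subsingleton.elim a r₁]
        exact hr
      have hf₂ : Set.range ⇑f₂ = Set.univ := by
        rw [← hA.vcover, hf₁, eq_comm, Set.union_eq_right, Set.singleton_subset_iff]
        exact Set.mem_range_self r₂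
      let e : G₂ ≃g A := RelIso.ofSurjective f₂ (Set.range_eq_univ.mp hf₂)
      rw [hf₁, hf₂, Set.inter_univ, coverDist_singleton]
      exact ecc_iso hG₂ e r₂
  rw [topDownDist, key, csInf_singleton]

lemma subtreeDist_of_childSet_eq_empty [Finite V₂]
    {T₁ : SimpleGraph V₁} {r₁ : V₁} {T₂ : SimpleGraph V₂} {r₂ : V₂}
    (h₁ : T₁.Connected) (h₂ : T₂.Connected) {v : V₁} {u : V₂} (hv : childSet T₁ r₁ v = ∅) :
    subtreeDist T₁ r₁ T₂ r₂ v u = heightV T₂ r₂ u := by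
  have : Subsingleton (subtreeSet T₁ r₁ v) := by
    rw [subtreeSet_eq_singleton h₁ hv]
    infer_instance
  rw [subtreeDist, topDownDist_of_subsingleton _ _ _ _ (connected_induce_subtreeSet h₂),
    ecc_induce_subtreeSet h₂]

lemma subtreeDist_comm (T₁ : SimpleGraph V₁) (r₁ : V₁) (T₂ : SimpleGraph V₂) (r₂ : V₂)
    (v : V₁) (u : V₂) : subtreeDist T₁ r₁ T₂ r₂ v u = subtreeDist T₂ r₂ T₁ r₁ u v :=
  topDownDist_comm _ _ _ _

end Amalgam

/-- if `v` (in `(T₁, r₁)`) or `u` (in `(T₂, r₂)`) is a leaf, then the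
optimal top-down amalgam distance of the subtrees rooted at `v` and `u` equals the
maximum of the heights of `v` and `u`. -/
theorem subtreeDist_of_leaf {V₁ V₂ : Type*} [Fintype V₁] [Fintype V₂]
    (T₁ : SimpleGraph V₁) (r₁ : V₁) (T₂ : SimpleGraph V₂) (r₂ : V₂)
    (h₁ : T₁.IsTree) (h₂ : T₂.IsTree)
    (v : V₁) (u : V₂)
    (hleaf : childSet T₁ r₁ v = ∅ ∨ childSet T₂ r₂ u = ∅) :
    subtreeDist T₁ r₁ T₂ r₂ v u = max (heightV T₁ r₁ v) (heightV T₂ r₂ u) := by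
  rcases hleaf with h | h
  · rw [heightV_eq_zero h₁.connected h, Nat.zero_max]
    exact subtreeDist_of_childSet_eq_empty h₁.connected h₂.connected h
  · rw [heightV_eq_zero h₂.connected h, Nat.max_zero, subtreeDist_comm]
    exact subtreeDist_of_childSet_eq_empty h₂.connected h₁.connected h
end HDTrees
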